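/- arXiv:2604.21113 — 7 statements merged into one kernel-verified Lean document; each statement's English description precedes it below -/
import Mathlib

section
/- Let n ≥ 1, let f = (f_1,…,f_n) ∈ 𝓑_c^n, let X = (X_1,…,X_n) be a random vector in ℝ^n with X ∈ 𝒯^d(f), and let g : ℝ^n → ℝ be continuous. Fix t ∈ ℝ and suppose there exists s_t ∈ (0,1] such that L(s_t) = (f_1^{-1}(s_t),…,f_n^{-1}(s_t)) belongs to the southwest boundary ∂_SW Q(g^{-1}[t,∞)). Then P(g(X) ≥ t) ≤ n·s_t. -/
open MeasureTheory Filter Set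

noncomputable section

/-- The southwest boundary of a set `V ⊆ [0,∞)^n`: the set of minimal elements of `V`
under the componentwise order. -/
def swBoundary {n : ℕ} (V : Set (Fin n → ℝ)) : Set (Fin n → ℝ) :=
  {x | x ∈ V ∧ ∀ y ∈ V, y ≤ x → y = x}

/-- The reflection map `Q(x₁,…,xₙ) = (|x₁|,…,|xₙ|)`. -/
def Qmap {n : ℕ} (x : Fin n → ℝ) : Fin n → ℝ := fun i => |x i|

/-- **Theorem 1 (Tail bounds via the southwest boundary).**
If `X ∈ 𝒯^d(f)` with `f ∈ 𝓑_c^n`, `g` is continuous, and there is `s_t ∈ (0,1]` such that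
`L(s_t) = (f₁⁻¹(s_t),…,fₙ⁻¹(s_t))` lies in `∂_SW Q(g⁻¹[t,∞))`, then
`P(g(X) ≥ t) ≤ n · s_t`. -/
theorem tail_bound_via_sw_boundary
    (n : ℕ) (hn : 1 ≤ n)
    (f : Fin n → ℝ → ℝ)
    (hf_cont : ∀ i, ContinuousOn (f i) (Ici 0))
    (hf_anti : ∀ i, StrictAntiOn (f i) (Ici 0))
    (hf_pos : ∀ i t, 0 ≤ t → 0 < f i t)
    (hf_one : ∀ i, 1 ≤ f i 0)
    (hf_lim : ∀ i, Tendsto (f i) atTop (nhds 0))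
    {Ω : Type*} [MeasurableSpace Ω] (μ : Measure Ω) [IsProbabilityMeasure μ]
    (X : Ω → Fin n → ℝ) (hX : Measurable X)
    (hTail : ∀ i t, 0 ≤ t → μ {ω | t ≤ |X ω i|} ≤ ENNReal.ofReal (f i t))
    (g : (Fin n → ℝ) → ℝ) (hg : Continuous g)
    (t : ℝ) (s_t : ℝ) (hs_pos : 0 < s_t) (hs_le : s_t ≤ 1)
    (xstar : Fin n → ℝ) (hxstar_nonneg : ∀ i, 0 ≤ xstar i)
    (hxstar_inv : ∀ i, f i (xstar i) = s_t)
    (hxstar_mem : xstar ∈ swBoundary (Qmap '' (g ⁻¹' Ici t))) :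
    μ {ω | t ≤ g (X ω)} ≤ ENNReal.ofReal (n * s_t) := by
  have hsub : {ω | t ≤ g (X ω)} ⊆ ⋃ i, {ω | xstar i ≤ |X ω i|} := by
    intro ω hω
    by_contra hnot
    simp only [mem_iUnion, mem_ofPred_eq, not_exists, not_le] at hnot
    have heq : Qmap (X ω) = xstar :=
      hxstar_mem.2 _ ⟨X ω, hω, rfl⟩ fun i => (hnot i).le
    exact (hnot ⟨0, hn⟩).ne (congrFun heq ⟨0, hn⟩)
  calc μ {ω | t ≤ g (X ω)}
      ≤ μ (⋃ i, {ω | xstar i ≤ |X ω i|}) := measure_mono hsub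
    _ ≤ ∑ i, μ {ω | xstar i ≤ |X ω i|} := measure_iUnion_fintype_le μ _
    _ ≤ ∑ _i : Fin n, ENNReal.ofReal s_t :=
        Finset.sum_le_sum fun i _ => hxstar_inv i ▸ hTail i (xstar i) (hxstar_nonneg i)
    _ = ENNReal.ofReal (n * s_t) := by
        simp [ENNReal.ofReal_mul]
end
end

section
/- Let n ≥ 1, let f = (f_1,…,f_n) ∈ 𝓑_c^n, and let X ∈ 𝒯^d(f). Let g : ℝ^n → ℝ be continuous, even in each coordinate (g is unchanged when any single coordinate x_i is replaced by −x_i), and such that when any n−1 coordinates are held fixed at nonnegative values, g is strictly increasing in the remaining coordinate on [0,∞). Define h(s) = g(f_1^{-1}(s),…,f_n^{-1}(s)) for s ∈ (0,1], and assume lim_{s↓0} h(s) = ∞. Then for every t ≥ h(1), P(g(X) ≥ t) ≤ n·h^{-1}(t), where h^{-1}(t) denotes the unique s ∈ (0,1] with h(s) = t. -/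
open MeasureTheory Filter Set

noncomputable section

section CoordinateFunctions

variable {n : ℕ} {g : (Fin n → ℝ) → ℝ}

/-- A function that is even in each coordinate depends only on the absolute values. -/
theorem apply_abs_of_even_update
    (hg : ∀ (x : Fin n → ℝ) (i : Fin n), g (Function.update x i (-(x i))) = g x)
    (x : Fin n → ℝ) : g (fun i => |x i|) = g x := by
  classical
  have key : ∀ S : Finset (Fin n), g (S.piecewise (fun i => |x i|) x) = g x := by
    intro S
    induction S using Finset.induction_on with
    | empty => simp
    | insert i S hi ih =>
      rw [Finset.piecewise_insert]
      have hxi : S.piecewise (fun i => |x i|) x i = x i := Finset.piecewise_eq_of_notMem _ _ _ hi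
      rcases abs_choice (x i) with h | h
      · rw [h, ← ih]
        congr 1
        rw [Function.update_eq_self_iff, hxi]
      · rw [h, ← ih, ← hg (S.piecewise (fun i => |x i|) x) i, hxi]
  simpa using key Finset.univ

/-- Coordinatewise strict monotonicity on the nonnegative orthant gives monotonicity there. -/
theorem apply_le_of_update_lt
    (hg : ∀ (x : Fin n → ℝ), (∀ j, 0 ≤ x j) → ∀ (i : Fin n) (a b : ℝ), 0 ≤ a → a < b →
      g (Function.update x i a) < g (Function.update x i b))
    {x y : Fin n → ℝ} (hx : ∀ j, 0 ≤ x j) (hxy : ∀ j, x j ≤ y j) : g x ≤ g y := by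
  classical
  have key : ∀ S : Finset (Fin n), g x ≤ g (S.piecewise y x) := by
    intro S
    induction S using Finset.induction_on with
    | empty => simp
    | insert i S hi ih =>
      rw [Finset.piecewise_insert]
      refine ih.trans ?_
      have hxi : S.piecewise y x i = x i := Finset.piecewise_eq_of_notMem _ _ _ hi
      have hself : Function.update (S.piecewise y x) i (x i) = S.piecewise y x := by
        rw [Function.update_eq_self_iff, hxi]
      rcases (hxy i).eq_or_lt with h | h
      · rw [← h, hself]
      · have hlt := hg (S.piecewise y x) (fun j => by
          by_cases hj : j ∈ S
          · rw [Finset.piecewise_eq_of_mem _ _ _ hj]; exact (hx j).trans (hxy j)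
          · rw [Finset.piecewise_eq_of_notMem _ _ _ hj]; exact hx j) i (x i) (y i) (hx i) h
        rw [hself] at hlt
        exact hlt.le
  simpa using key Finset.univ

theorem apply_lt_of_update_lt
    (hg : ∀ (x : Fin n → ℝ), (∀ j, 0 ≤ x j) → ∀ (i : Fin n) (a b : ℝ), 0 ≤ a → a < b →
      g (Function.update x i a) < g (Function.update x i b))
    {x y : Fin n → ℝ} (hx : ∀ j, 0 ≤ x j) (hxy : ∀ j, x j ≤ y j) {i : Fin n} (hi : x i < y i) :
    g x < g y := by
  have hlt := hg x hx i (x i) (y i) (hx i) hi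
  rw [Function.update_eq_self] at hlt
  refine hlt.trans_le (apply_le_of_update_lt hg (fun j => ?_) (fun j => ?_))
  · rcases eq_or_ne j i with rfl | hj
    · simpa using (hx j).trans hi.le
    · simpa [hj] using hx j
  · rcases eq_or_ne j i with rfl | hj
    · simp
    · simpa [hj] using hxy j

end CoordinateFunctions

section RightInverse

variable {f finv : ℝ → ℝ}

theorem rightInverse_strictAntiOn (hf : StrictAntiOn f (Ici 0))
    (hnonneg : ∀ s, 0 < s → s ≤ f 0 → 0 ≤ finv s)
    (heq : ∀ s, 0 < s → s ≤ f 0 → f (finv s) = s) :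
    StrictAntiOn finv (Ioc 0 (f 0)) := by
  intro a ha b hb hab
  rw [← hf.lt_iff_gt (hnonneg a ha.1 ha.2) (hnonneg b hb.1 hb.2), heq a ha.1 ha.2,
    heq b hb.1 hb.2]
  exact hab

theorem rightInverse_continuousOn (hf : StrictAntiOn f (Ici 0))
    (hnonneg : ∀ s, 0 < s → s ≤ f 0 → 0 ≤ finv s)
    (heq : ∀ s, 0 < s → s ≤ f 0 → f (finv s) = s) :
    ContinuousOn finv (Ioc 0 (f 0)) := by
  intro s hs
  have hs0 := hnonneg s hs.1 hs.2
  refine tendsto_order.2 ⟨fun a ha => ?_, fun b hb => ?_⟩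
  · rcases lt_or_ge a 0 with ha0 | ha0
    · filter_upwards [self_mem_nhdsWithin] with r hr
      exact ha0.trans_le (hnonneg r hr.1 hr.2)
    · have hfa : s < f a := by
        have := hf ha0 hs0 ha
        rwa [heq s hs.1 hs.2] at this
      filter_upwards [self_mem_nhdsWithin, mem_nhdsWithin_of_mem_nhds (Iio_mem_nhds hfa)]
        with r hr hra
      rw [← hf.lt_iff_gt (hnonneg r hr.1 hr.2) ha0, heq r hr.1 hr.2]
      exact hra
  · have hb0 : 0 ≤ b := hs0.trans hb.le
    have hfb : f b < s := by
      have := hf hs0 hb0 hb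
      rwa [heq s hs.1 hs.2] at this
    filter_upwards [self_mem_nhdsWithin, mem_nhdsWithin_of_mem_nhds (Ioi_mem_nhds hfb)]
      with r hr hrb
    rw [← hf.lt_iff_gt hb0 (hnonneg r hr.1 hr.2), heq r hr.1 hr.2]
    exact hrb

end RightInverse

/-- **Theorem 2.** Let `X ∈ 𝒯^d(f)` with `f ∈ 𝓑_c^n`, and let `g` be continuous, even in each
coordinate, and strictly increasing in each coordinate on `[0,∞)` when the other coordinates
are held fixed at nonnegative values. With `h(s) = g(f₁⁻¹(s),…,fₙ⁻¹(s))` on `(0,1]` and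
`lim_{s↓0} h(s) = ∞`, for every `t ≥ h(1)` there is a unique `s ∈ (0,1]` with `h(s) = t`
(namely `s = h⁻¹(t)`), and `P(g(X) ≥ t) ≤ n · h⁻¹(t)`. -/
theorem tail_bound_monotone_even
    (n : ℕ) (hn : 1 ≤ n)
    (f : Fin n → ℝ → ℝ)
    (hf_cont : ∀ i, ContinuousOn (f i) (Ici 0))
    (hf_anti : ∀ i, StrictAntiOn (f i) (Ici 0))
    (hf_pos : ∀ i t, 0 ≤ t → 0 < f i t)
    (hf_one : ∀ i, 1 ≤ f i 0)
    (hf_lim : ∀ i, Tendsto (f i) atTop (nhds 0))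
    {Ω : Type*} [MeasurableSpace Ω] (μ : Measure Ω) [IsProbabilityMeasure μ]
    (X : Ω → Fin n → ℝ) (hX : Measurable X)
    (hTail : ∀ i t, 0 ≤ t → μ {ω | t ≤ |X ω i|} ≤ ENNReal.ofReal (f i t))
    (g : (Fin n → ℝ) → ℝ) (hg_cont : Continuous g)
    (hg_even : ∀ (x : Fin n → ℝ) (i : Fin n), g (Function.update x i (-(x i))) = g x)
    (hg_mono : ∀ (x : Fin n → ℝ), (∀ j, 0 ≤ x j) → ∀ (i : Fin n) (a b : ℝ), 0 ≤ a → a < b →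
      g (Function.update x i a) < g (Function.update x i b))
    (finv : Fin n → ℝ → ℝ)
    (hfinv_nonneg : ∀ i s, 0 < s → s ≤ f i 0 → 0 ≤ finv i s)
    (hfinv_eq : ∀ i s, 0 < s → s ≤ f i 0 → f i (finv i s) = s)
    (h : ℝ → ℝ) (hh : ∀ s, h s = g (fun i => finv i s))
    (hh_lim : Tendsto h (nhdsWithin 0 (Ioi 0)) atTop)
    (t : ℝ) (ht : h 1 ≤ t) :
    ∃ s : ℝ, (s ∈ Ioc (0 : ℝ) 1 ∧ h s = t ∧
        μ {ω | t ≤ g (X ω)} ≤ ENNReal.ofReal (n * s)) ∧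
      ∀ s' : ℝ, s' ∈ Ioc (0 : ℝ) 1 → h s' = t → s' = s := by
  have hsub : ∀ i, Ioc (0 : ℝ) 1 ⊆ Ioc 0 (f i 0) := fun i => Ioc_subset_Ioc_right (hf_one i)
  have hnn : ∀ s ∈ Ioc (0 : ℝ) 1, ∀ i, 0 ≤ finv i s := fun s hs i =>
    hfinv_nonneg i s hs.1 (hsub i hs).2
  have hanti : StrictAntiOn h (Ioc 0 1) := by
    intro a ha b hb hab
    have hlt : ∀ i, finv i b < finv i a := fun i =>
      rightInverse_strictAntiOn (hf_anti i) (hfinv_nonneg i) (hfinv_eq i)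
        (hsub i ha) (hsub i hb) hab
    rw [hh, hh]
    exact apply_lt_of_update_lt hg_mono (hnn b hb) (fun j => (hlt j).le) (hlt ⟨0, hn⟩)
  have hcont : ContinuousOn h (Ioc 0 1) := by
    rw [funext hh]
    exact hg_cont.comp_continuousOn (continuousOn_pi.2 fun i =>
      (rightInverse_continuousOn (hf_anti i) (hfinv_nonneg i) (hfinv_eq i)).mono (hsub i))
  obtain ⟨r, hrt, hr⟩ : ∃ r, t ≤ h r ∧ r ∈ Ioo (0 : ℝ) 1 :=
    ((hh_lim.eventually_ge_atTop t).and (Ioo_mem_nhdsGT one_pos)).exists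
  obtain ⟨s, hs, hst⟩ := intermediate_value_Icc' hr.2.le
    (hcont.mono fun u hu => ⟨hr.1.trans_le hu.1, hu.2⟩) ⟨ht, hrt⟩
  have hs01 : s ∈ Ioc (0 : ℝ) 1 := ⟨hr.1.trans_le hs.1, hs.2⟩
  refine ⟨s, ⟨hs01, hst, ?_⟩, fun u hu hut => hanti.injOn hu hs01 (hut.trans hst.symm)⟩
  have hcover : {ω | t ≤ g (X ω)} ⊆ ⋃ i, {ω | finv i s ≤ |X ω i|} := by
    intro ω hω
    by_contra hcon
    simp only [mem_iUnion, mem_ofPred_eq, not_exists, not_le] at hcon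
    have hlt := apply_lt_of_update_lt hg_mono (x := fun i => |X ω i|) (y := fun i => finv i s)
      (fun j => abs_nonneg _) (fun j => (hcon j).le) (hcon ⟨0, hn⟩)
    rw [apply_abs_of_even_update hg_even, ← hh, hst] at hlt
    exact hlt.not_ge hω
  calc μ {ω | t ≤ g (X ω)} ≤ μ (⋃ i, {ω | finv i s ≤ |X ω i|}) := measure_mono hcover
    _ ≤ ∑ i, μ {ω | finv i s ≤ |X ω i|} := measure_iUnion_fintype_le _ _
    _ ≤ ∑ _i : Fin n, ENNReal.ofReal s := Finset.sum_le_sum fun i _ => by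
        simpa only [hfinv_eq i s hs01.1 (hsub i hs01).2] using hTail i _ (hnn s hs01 i)
    _ = ENNReal.ofReal (n * s) := by
        rw [ENNReal.ofReal_mul (Nat.cast_nonneg n), ENNReal.ofReal_natCast]
        simp
end
end

section
/- Let n ≥ 1, let f = (f_1,…,f_n) ∈ 𝓑_c^n with f_1(0) = f_2(0) = ⋯ = f_n(0), and let X ∈ 𝒯^d(f). Let g : ℝ^n → ℝ be continuous, even in each coordinate, and such that when any n−1 coordinates are held fixed at nonnegative values, g is strictly increasing in the remaining coordinate on [0,∞). Define h(s) = g(f_1^{-1}(s),…,f_n^{-1}(s)) for s ∈ (0, f_1(0)], and assume lim_{s↓0} h(s) = ∞. Then for every t ≥ g(0,…,0), P(g(X) ≥ t) ≤ n·h^{-1}(t), where h^{-1}(t) denotes the unique s ∈ (0, f_1(0)] with h(s) = t. -/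
open MeasureTheory Filter Set

noncomputable section

/-- A function on `ι → ℝ` that is even in each coordinate is unchanged by taking absolute values
of all coordinates. -/
lemma apply_abs_eq_of_even_coordinates {ι : Type*} [Fintype ι] [DecidableEq ι]
    {g : (ι → ℝ) → ℝ}
    (hg_even : ∀ (x : ι → ℝ) (i : ι), g (Function.update x i (-(x i))) = g x) (x : ι → ℝ) :
    g (fun i => |x i|) = g x := by
  have key : ∀ S : Finset ι, g (S.piecewise (fun i => |x i|) x) = g x := by
    intro S
    induction S using Finset.induction_on with
    | empty => simp
    | insert a T ha ih =>
      rw [Finset.piecewise_insert, ← ih]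
      have hp : T.piecewise (fun i => |x i|) x a = x a := Finset.piecewise_eq_of_notMem _ _ _ ha
      rcases abs_choice (x a) with h | h
      · rw [h, ← hp, Function.update_eq_self]
      · rw [h, ← hp, hg_even]
  simpa using key Finset.univ

/-- A function that is strictly increasing in each coordinate on the nonnegative orthant is
strictly increasing under simultaneous strict increase of all coordinates. -/
lemma apply_lt_apply_of_strictMono_coordinates {ι : Type*} [Fintype ι] [Nonempty ι]
    [DecidableEq ι] {g : (ι → ℝ) → ℝ}
    (hg_mono : ∀ (x : ι → ℝ), (∀ j, 0 ≤ x j) → ∀ (i : ι) (a b : ℝ), 0 ≤ a → a < b →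
      g (Function.update x i a) < g (Function.update x i b))
    {x y : ι → ℝ} (hx : ∀ i, 0 ≤ x i) (hxy : ∀ i, x i < y i) : g x < g y := by
  have key : ∀ S : Finset ι, S.Nonempty → g x < g (S.piecewise y x) := by
    intro S hS
    induction S using Finset.induction_on with
    | empty => simp at hS
    | insert a T ha ih =>
      rw [Finset.piecewise_insert]
      have hp : T.piecewise y x a = x a := Finset.piecewise_eq_of_notMem _ _ _ ha
      have hnonneg : ∀ j, 0 ≤ T.piecewise y x j := fun j => by
        by_cases hj : j ∈ T
        · simpa [hj] using (hx j).trans (hxy j).le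
        · simpa [hj] using hx j
      have step := hg_mono _ hnonneg a (x a) (y a) (hx a) (hxy a)
      rw [← hp, Function.update_eq_self] at step
      rcases T.eq_empty_or_nonempty with rfl | hT
      · simpa using step
      · exact (ih hT).trans step
  simpa using key Finset.univ Finset.univ_nonempty

/-- A right inverse with values in `[0, ∞)` of a strictly decreasing function on `[0, ∞)` is
continuous. -/
lemma StrictAntiOn.continuousOn_rightInverse {f φ : ℝ → ℝ} {s : Set ℝ}
    (hf : StrictAntiOn f (Ici 0)) (hφ : ∀ u ∈ s, 0 ≤ φ u) (hfφ : ∀ u ∈ s, f (φ u) = u) :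
    ContinuousOn φ s := by
  intro u hu
  refine tendsto_order.2 ⟨fun a ha => ?_, fun b hb => ?_⟩
  · rcases lt_or_ge a 0 with h0 | h0
    · filter_upwards [self_mem_nhdsWithin] with v hv
      exact h0.trans_le (hφ v hv)
    · have hlt : u < f a := by
        simpa [hfφ u hu] using hf (mem_Ici.2 h0) (mem_Ici.2 (hφ u hu)) ha
      filter_upwards [self_mem_nhdsWithin, mem_nhdsWithin_of_mem_nhds (Iio_mem_nhds hlt)]
        with v hv hva
      rw [← hf.lt_iff_gt (mem_Ici.2 (hφ v hv)) (mem_Ici.2 h0), hfφ v hv]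
      exact hva
  · have hb0 : 0 ≤ b := (hφ u hu).trans hb.le
    have hlt : f b < u := by
      simpa [hfφ u hu] using hf (mem_Ici.2 (hφ u hu)) (mem_Ici.2 hb0) hb
    filter_upwards [self_mem_nhdsWithin, mem_nhdsWithin_of_mem_nhds (Ioi_mem_nhds hlt)]
      with v hv hvb
    rw [← hf.lt_iff_gt (mem_Ici.2 hb0) (mem_Ici.2 (hφ v hv)), hfφ v hv]
    exact hvb

/-- **Theorem 2, extended range.** If in addition `f₁(0) = ⋯ = fₙ(0) = c`, then with
`h(s) = g(f₁⁻¹(s),…,fₙ⁻¹(s))` defined on the larger domain `(0, c]`, for every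
`t ≥ g(0,…,0)` there is a unique `s ∈ (0, c]` with `h(s) = t` and
`P(g(X) ≥ t) ≤ n · h⁻¹(t)`. -/
theorem tail_bound_monotone_even_extended
    (n : ℕ) (hn : 1 ≤ n)
    (f : Fin n → ℝ → ℝ)
    (hf_cont : ∀ i, ContinuousOn (f i) (Ici 0))
    (hf_anti : ∀ i, StrictAntiOn (f i) (Ici 0))
    (hf_pos : ∀ i t, 0 ≤ t → 0 < f i t)
    (hf_one : ∀ i, 1 ≤ f i 0)
    (hf_lim : ∀ i, Tendsto (f i) atTop (nhds 0))
    (c : ℝ) (hf_zero : ∀ i, f i 0 = c)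
    {Ω : Type*} [MeasurableSpace Ω] (μ : Measure Ω) [IsProbabilityMeasure μ]
    (X : Ω → Fin n → ℝ) (hX : Measurable X)
    (hTail : ∀ i t, 0 ≤ t → μ {ω | t ≤ |X ω i|} ≤ ENNReal.ofReal (f i t))
    (g : (Fin n → ℝ) → ℝ) (hg_cont : Continuous g)
    (hg_even : ∀ (x : Fin n → ℝ) (i : Fin n), g (Function.update x i (-(x i))) = g x)
    (hg_mono : ∀ (x : Fin n → ℝ), (∀ j, 0 ≤ x j) → ∀ (i : Fin n) (a b : ℝ), 0 ≤ a → a < b →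
      g (Function.update x i a) < g (Function.update x i b))
    (finv : Fin n → ℝ → ℝ)
    (hfinv_nonneg : ∀ i s, 0 < s → s ≤ c → 0 ≤ finv i s)
    (hfinv_eq : ∀ i s, 0 < s → s ≤ c → f i (finv i s) = s)
    (h : ℝ → ℝ) (hh : ∀ s, h s = g (fun i => finv i s))
    (hh_lim : Tendsto h (nhdsWithin 0 (Ioi 0)) atTop)
    (t : ℝ) (ht : g (fun _ => 0) ≤ t) :
    ∃ s : ℝ, (s ∈ Ioc (0 : ℝ) c ∧ h s = t ∧
        μ {ω | t ≤ g (X ω)} ≤ ENNReal.ofReal (n * s)) ∧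
      ∀ s' : ℝ, s' ∈ Ioc (0 : ℝ) c → h s' = t → s' = s := by
  have : Nonempty (Fin n) := ⟨⟨0, hn⟩⟩
  have hc : 0 < c := by
    have h1 := hf_one ⟨0, hn⟩
    rw [hf_zero] at h1
    linarith
  have h_anti : StrictAntiOn h (Ioc 0 c) := by
    intro u hu v hv huv
    rw [hh, hh]
    refine apply_lt_apply_of_strictMono_coordinates hg_mono
      (fun i => hfinv_nonneg i v hv.1 hv.2) fun i => ?_
    rw [← (hf_anti i).lt_iff_gt (mem_Ici.2 (hfinv_nonneg i u hu.1 hu.2))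
      (mem_Ici.2 (hfinv_nonneg i v hv.1 hv.2)), hfinv_eq i u hu.1 hu.2, hfinv_eq i v hv.1 hv.2]
    exact huv
  have h_cont : ContinuousOn h (Ioc 0 c) := by
    rw [funext hh]
    exact hg_cont.comp_continuousOn <| continuousOn_pi.2 fun i =>
      (hf_anti i).continuousOn_rightInverse (fun u hu => hfinv_nonneg i u hu.1 hu.2)
        fun u hu => hfinv_eq i u hu.1 hu.2
  have h_c : h c ≤ t := by
    have hzero : (fun i => finv i c) = fun _ => 0 := funext fun i =>
      (hf_anti i).injOn (mem_Ici.2 (hfinv_nonneg i c hc le_rfl)) (mem_Ici.2 le_rfl)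
        ((hfinv_eq i c hc le_rfl).trans (hf_zero i).symm)
    rwa [hh, hzero]
  obtain ⟨r, hrt, hr⟩ := ((hh_lim.eventually_ge_atTop t).and (Ioc_mem_nhdsGT hc)).exists
  obtain ⟨s, hs, hst⟩ := intermediate_value_Icc' hr.2
    (h_cont.mono fun u hu => ⟨hr.1.trans_le hu.1, hu.2⟩) ⟨h_c, hrt⟩
  have hsc : s ∈ Ioc 0 c := ⟨hr.1.trans_le hs.1, hs.2⟩
  refine ⟨s, ⟨hsc, hst, ?_⟩, fun s' hs' hs't => h_anti.injOn hs' hsc (hs't.trans hst.symm)⟩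
  have hsub : {ω | t ≤ g (X ω)} ⊆ ⋃ i, {ω | finv i s ≤ |X ω i|} := by
    intro ω hω
    by_contra hcon
    simp only [mem_iUnion, mem_ofPred_eq, not_exists, not_le] at hcon hω
    have hlt := apply_lt_apply_of_strictMono_coordinates hg_mono
      (fun i => abs_nonneg (X ω i)) hcon
    rw [apply_abs_eq_of_even_coordinates hg_even, ← hh, hst] at hlt
    exact hω.not_gt hlt
  calc μ {ω | t ≤ g (X ω)} ≤ μ (⋃ i, {ω | finv i s ≤ |X ω i|}) := measure_mono hsub
    _ ≤ ∑ i, μ {ω | finv i s ≤ |X ω i|} := measure_iUnion_fintype_le _ _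
    _ ≤ ∑ _i : Fin n, ENNReal.ofReal s := Finset.sum_le_sum fun i _ => by
        simpa only [hfinv_eq i s hsc.1 hsc.2] using
          hTail i (finv i s) (hfinv_nonneg i s hsc.1 hsc.2)
    _ = ENNReal.ofReal (n * s) := by
        rw [ENNReal.ofReal_mul n.cast_nonneg]
        simp
end
end

section
/- Let n ≥ 1 and let g : ℝ^n → ℝ be continuous, even in each coordinate, and such that when any n−1 coordinates are held fixed at nonnegative values, g is strictly increasing in the remaining coordinate on [0,∞). For t ≥ g(0,…,0), let V_t = { x ∈ [0,∞)^n : g(x) ≥ t }. Then the southwest boundary of V_t equals the nonnegative level set of g at t: ∂_SW V_t = g^{-1}({t}) ∩ [0,∞)^n. -/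
open Set

noncomputable section

/-- A function that is strictly increasing in each coordinate on the nonnegative orthant is
monotone there. -/
theorem monotoneOn_of_coordinatewise_strictMono {n : ℕ} {g : (Fin n → ℝ) → ℝ}
    (hg : ∀ (x : Fin n → ℝ), (∀ j, 0 ≤ x j) → ∀ (i : Fin n) (a b : ℝ), 0 ≤ a → a < b →
      g (Function.update x i a) < g (Function.update x i b)) :
    MonotoneOn g {x | ∀ i, 0 ≤ x i} := by
  intro y hy x hx hyx
  have key : ∀ s : Finset (Fin n), g y ≤ g (s.piecewise x y) := by
    intro s
    induction s using Finset.induction_on with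
    | empty => simp
    | insert j s hj ih =>
      rw [Finset.piecewise_insert]
      have hnonneg : ∀ k, 0 ≤ s.piecewise x y k := fun k => by
        by_cases hk : k ∈ s
        · simpa [hk] using hx k
        · simpa [hk] using hy k
      have hval : s.piecewise x y j = y j := Finset.piecewise_eq_of_notMem _ _ _ hj
      have hupd : Function.update (s.piecewise x y) j (y j) = s.piecewise x y := by
        rw [← hval, Function.update_eq_self]
      rcases (hyx j).eq_or_lt with h | h
      · rwa [← h, hupd]
      · have := hg _ hnonneg j (y j) (x j) (hy j) h
        rw [hupd] at this
        exact ih.trans this.le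
  simpa using key Finset.univ

/-- A function that is strictly increasing in each coordinate on the nonnegative orthant is
strictly monotone there. -/
theorem strictMonoOn_of_coordinatewise_strictMono {n : ℕ} {g : (Fin n → ℝ) → ℝ}
    (hg : ∀ (x : Fin n → ℝ), (∀ j, 0 ≤ x j) → ∀ (i : Fin n) (a b : ℝ), 0 ≤ a → a < b →
      g (Function.update x i a) < g (Function.update x i b)) :
    StrictMonoOn g {x | ∀ i, 0 ≤ x i} := by
  intro y hy x hx hyx
  obtain ⟨hle, i, hi⟩ := Pi.lt_def.mp hyx
  have hlt := hg y hy i (y i) (x i) (hy i) hi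
  rw [Function.update_eq_self] at hlt
  refine hlt.trans_le (monotoneOn_of_coordinatewise_strictMono hg ?_ hx ?_)
  · intro k
    rcases eq_or_ne k i with rfl | hk
    · simpa using hx k
    · simpa [hk] using hy k
  · exact update_le_iff.mpr ⟨le_rfl, fun k _ => hle k⟩

/-- If `g` is continuous, even in each coordinate, and strictly increasing in each coordinate
on `[0,∞)` when the others are held fixed at nonnegative values, then for `t ≥ g(0,…,0)`,
the southwest boundary of `V_t = {x ∈ [0,∞)^n : g(x) ≥ t}` equals
`g⁻¹({t}) ∩ [0,∞)^n`. -/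
theorem sw_boundary_eq_level_set
    (n : ℕ) (hn : 1 ≤ n)
    (g : (Fin n → ℝ) → ℝ) (hg_cont : Continuous g)
    (hg_even : ∀ (x : Fin n → ℝ) (i : Fin n), g (Function.update x i (-(x i))) = g x)
    (hg_mono : ∀ (x : Fin n → ℝ), (∀ j, 0 ≤ x j) → ∀ (i : Fin n) (a b : ℝ), 0 ≤ a → a < b →
      g (Function.update x i a) < g (Function.update x i b))
    (t : ℝ) (ht : g (fun _ => 0) ≤ t) :
    swBoundary {x : Fin n → ℝ | (∀ i, 0 ≤ x i) ∧ t ≤ g x} =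
      g ⁻¹' {t} ∩ {x : Fin n → ℝ | ∀ i, 0 ≤ x i} := by
  ext x
  constructor
  · rintro ⟨⟨hx, hxt⟩, hmin⟩
    have hcont : ContinuousOn (fun s : ℝ => g (s • x)) (Icc 0 1) := by fun_prop
    have hmem : t ∈ Icc (g ((0 : ℝ) • x)) (g ((1 : ℝ) • x)) := by
      rw [zero_smul, one_smul]
      exact ⟨ht, hxt⟩
    obtain ⟨s, ⟨hs0, hs1⟩, hs⟩ := intermediate_value_Icc zero_le_one hcont hmem
    have hsx : s • x = x := hmin (s • x) ⟨fun i => mul_nonneg hs0 (hx i), hs.ge⟩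
      fun i => mul_le_of_le_one_left (hx i) hs1
    refine ⟨?_, hx⟩
    simpa [hsx] using hs
  · rintro ⟨hxt, hx⟩
    have hxt : g x = t := hxt
    refine ⟨⟨hx, hxt.ge⟩, fun y hy hyx => ?_⟩
    by_contra hne
    have hlt := strictMonoOn_of_coordinatewise_strictMono hg_mono hy.1 hx (lt_of_le_of_ne hyx hne)
    exact absurd hy.2 (not_le.mpr (hxt ▸ hlt))
end
end

section
/- Let n ≥ 1, let f ∈ 𝓑_c, and let X = (X_1,…,X_n) be a random vector with P(|X_i| ≥ t) ≤ f(t) for all t ≥ 0 and all i. Let g : ℝ^n → ℝ be a homogeneous polynomial of degree k ≥ 1 plus a constant C, with nonzero monomial coefficients a_1,…,a_m (so ∑_i |a_i| > 0). Then for every t ≥ C, P(g(X) ≥ t) ≤ n · f( (t − C)^{1/k} / (∑_i |a_i|)^{1/k} ). -/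
open MeasureTheory Filter Set

noncomputable section

/-- A homogeneous polynomial is bounded by its coefficients on a sup-norm ball. -/
lemma MvPolynomial.IsHomogeneous.eval_le_sum_abs_coeff_mul_pow {σ : Type*} {k : ℕ}
    {p : MvPolynomial σ ℝ} (hp : p.IsHomogeneous k) {x : σ → ℝ} {M : ℝ}
    (hx : ∀ i, |x i| ≤ M) :
    MvPolynomial.eval x p ≤ (∑ d ∈ p.support, |MvPolynomial.coeff d p|) * M ^ k := by
  rw [MvPolynomial.eval_eq, Finset.sum_mul]
  refine Finset.sum_le_sum fun d hd ↦ (le_abs_self _).trans ?_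
  rw [abs_mul, Finset.abs_prod]
  refine mul_le_mul_of_nonneg_left ?_ (abs_nonneg _)
  have hdeg : ∑ i ∈ d.support, d i = k := by
    rw [← hp.degree_eq_sum_deg_support hd]
  calc ∏ i ∈ d.support, |x i ^ d i| ≤ ∏ i ∈ d.support, M ^ d i := by
        refine Finset.prod_le_prod (fun i _ ↦ abs_nonneg _) fun i _ ↦ ?_
        rw [abs_pow]
        exact pow_le_pow_left₀ (abs_nonneg _) (hx i) _
    _ = M ^ k := by rw [Finset.prod_pow_eq_pow_sum, hdeg]

/-- Where a homogeneous polynomial of positive degree is large, some coordinate is large. -/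
lemma MvPolynomial.IsHomogeneous.exists_le_abs_of_le_eval {σ : Type*} [Finite σ] [Nonempty σ]
    {k : ℕ} (hk : k ≠ 0) {p : MvPolynomial σ ℝ} (hp : p.IsHomogeneous k)
    (hA : 0 < ∑ d ∈ p.support, |MvPolynomial.coeff d p|) {x : σ → ℝ} {s : ℝ}
    (hs : (∑ d ∈ p.support, |MvPolynomial.coeff d p|) * s ^ k ≤ MvPolynomial.eval x p) :
    ∃ i, s ≤ |x i| := by
  obtain ⟨i, hi⟩ := Finite.exists_max fun i ↦ |x i|
  refine ⟨i, le_of_not_gt fun hlt ↦ ?_⟩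
  have hpow : |x i| ^ k < s ^ k := pow_lt_pow_left₀ hlt (abs_nonneg _) hk
  exact (hs.trans (hp.eval_le_sum_abs_coeff_mul_pow hi)).not_gt (mul_lt_mul_of_pos_left hpow hA)

/-- **Corollary (homogeneous polynomial case).** If all coordinates of `X` satisfy the same
tail bound `f ∈ 𝓑_c` and `g = p + C` where `p` is a homogeneous polynomial of degree `k ≥ 1`
with nonzero monomial coefficients `a_i`, then for every `t ≥ C`,
`P(g(X) ≥ t) ≤ n · f((t − C)^{1/k} / (∑_i |a_i|)^{1/k})`. -/
theorem tail_bound_homogeneous_polynomial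
    (n k : ℕ) (hn : 1 ≤ n) (hk : 1 ≤ k)
    (p : MvPolynomial (Fin n) ℝ) (hp : p.IsHomogeneous k)
    (C : ℝ)
    (hA : 0 < ∑ d ∈ p.support, |MvPolynomial.coeff d p|)
    (f : ℝ → ℝ)
    (hf_cont : ContinuousOn f (Ici 0))
    (hf_anti : StrictAntiOn f (Ici 0))
    (hf_pos : ∀ t, 0 ≤ t → 0 < f t)
    (hf_one : 1 ≤ f 0)
    (hf_lim : Tendsto f atTop (nhds 0))
    {Ω : Type*} [MeasurableSpace Ω] (μ : Measure Ω) [IsProbabilityMeasure μ]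
    (X : Ω → Fin n → ℝ) (hX : Measurable X)
    (hTail : ∀ i t, 0 ≤ t → μ {ω | t ≤ |X ω i|} ≤ ENNReal.ofReal (f t))
    (t : ℝ) (ht : C ≤ t) :
    μ {ω | t ≤ MvPolynomial.eval (X ω) p + C} ≤
      ENNReal.ofReal (n * f ((t - C) ^ (1 / (k : ℝ)) /
        (∑ d ∈ p.support, |MvPolynomial.coeff d p|) ^ (1 / (k : ℝ)))) := by
  have : Nonempty (Fin n) := ⟨⟨0, hn⟩⟩
  have hk0 : k ≠ 0 := Nat.one_le_iff_ne_zero.mp hk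
  have htC : 0 ≤ t - C := sub_nonneg.mpr ht
  set A := ∑ d ∈ p.support, |MvPolynomial.coeff d p|
  set s := (t - C) ^ (1 / (k : ℝ)) / A ^ (1 / (k : ℝ)) with hs
  have hs0 : 0 ≤ s := by positivity
  have hsk : A * s ^ k = t - C := by
    rw [hs, div_pow, one_div, Real.rpow_inv_natCast_pow htC hk0,
      Real.rpow_inv_natCast_pow hA.le hk0, mul_div_cancel₀ _ hA.ne']
  have hsub : {ω | t ≤ MvPolynomial.eval (X ω) p + C} ⊆ ⋃ i, {ω | s ≤ |X ω i|} := by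
    intro ω hω
    refine mem_iUnion.mpr (hp.exists_le_abs_of_le_eval hk0 hA ?_)
    exact hsk.le.trans (sub_le_iff_le_add.mpr hω)
  calc μ {ω | t ≤ MvPolynomial.eval (X ω) p + C}
      ≤ μ (⋃ i, {ω | s ≤ |X ω i|}) := measure_mono hsub
    _ ≤ ∑ i, μ {ω | s ≤ |X ω i|} := measure_iUnion_fintype_le _ _
    _ ≤ ∑ _i : Fin n, ENNReal.ofReal (f s) := Finset.sum_le_sum fun i _ ↦ hTail i s hs0
    _ = ENNReal.ofReal (n * f s) := by
        rw [ENNReal.ofReal_mul n.cast_nonneg, ENNReal.ofReal_natCast]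
        simp
end
end

section
/- Let f ∈ 𝓑_c and let X = (X_1,…,X_n) be a random vector (components possibly dependent) with P(|X_i| ≥ t) ≤ f(t) for all t ≥ 0 and all i. Let g : ℝ^n → ℝ be a homogeneous polynomial of degree k ≥ 1 plus a constant C, written as a sum of m monomials with nonzero coefficients a_1,…,a_m (so ∑_i |a_i| > 0), and for each i let k_i be the number of distinct variables appearing in the i-th monomial (not counting multiplicities). Then for every t ≥ C, P( g(X) ≥ t ) ≤ ( ∑_{i=1}^m k_i ) · f( (t − C)^{1/k} / (∑_i |a_i|)^{1/k} ). -/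
open MeasureTheory Filter Set

noncomputable section

/-- A nonconstant monic monomial is strictly smaller in absolute value than `s ^ degree` as soon as
all of its variables are strictly smaller than `s` in absolute value. -/
theorem abs_prod_pow_lt_pow_degree {σ : Type*} (d : σ →₀ ℕ) (hd : d.support.Nonempty)
    (x : σ → ℝ) (s : ℝ) (h : ∀ i ∈ d.support, |x i| < s) :
    |∏ i ∈ d.support, x i ^ d i| < s ^ (∑ i ∈ d.support, d i) := by
  have hs : 0 < s := by
    obtain ⟨i, hi⟩ := hd
    exact (abs_nonneg _).trans_lt (h i hi)
  rw [Finset.abs_prod, ← Finset.prod_pow_eq_pow_sum]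
  by_cases h0 : ∃ i ∈ d.support, x i = 0
  · obtain ⟨i, hi, hxi⟩ := h0
    rw [Finset.prod_eq_zero hi (by simp [hxi, Finsupp.mem_support_iff.mp hi])]
    exact Finset.prod_pos fun _ _ => pow_pos hs _
  · push Not at h0
    refine Finset.prod_lt_prod_of_nonempty (fun i hi => ?_) (fun i hi => ?_) hd
    · exact abs_pos.mpr (pow_ne_zero _ (h0 i hi))
    · rw [abs_pow]
      exact pow_lt_pow_left₀ (h i hi) (abs_nonneg _) (Finsupp.mem_support_iff.mp hi)

/-- A nonzero homogeneous polynomial of positive degree `k` is strictly smaller than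
`(∑ |a_d|) * s ^ k` wherever all variables occurring in it are smaller than `s` in absolute
value. -/
theorem eval_lt_of_forall_abs_lt {σ : Type*} {k : ℕ} (hk : 1 ≤ k) (p : MvPolynomial σ ℝ)
    (hp : p.IsHomogeneous k) (hp0 : p.support.Nonempty) (x : σ → ℝ) (s : ℝ)
    (h : ∀ d ∈ p.support, ∀ i ∈ d.support, |x i| < s) :
    MvPolynomial.eval x p < (∑ d ∈ p.support, |MvPolynomial.coeff d p|) * s ^ k := by
  rw [MvPolynomial.eval_eq, Finset.sum_mul]
  refine Finset.sum_lt_sum_of_nonempty hp0 fun d hd => ?_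
  have hc : MvPolynomial.coeff d p ≠ 0 := MvPolynomial.mem_support_iff.mp hd
  have hdeg : ∑ i ∈ d.support, d i = k := by
    have hw := hp hc
    rwa [show Finsupp.weight (1 : σ → ℕ) d = d.degree from
      (DFunLike.congr_fun Finsupp.degree_eq_weight_one d).symm, Finsupp.degree_apply] at hw
  have hne : d.support.Nonempty := by
    rw [Finset.nonempty_iff_ne_empty]
    intro he
    rw [he, Finset.sum_empty] at hdeg
    omega
  refine (le_abs_self _).trans_lt ?_
  rw [abs_mul, ← hdeg]
  exact mul_lt_mul_of_pos_left (abs_prod_pow_lt_pow_degree d hne x s (h d hd)) (abs_pos.mpr hc)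

/-- **Union bound for a homogeneous polynomial plus a constant.** If `g = p + C` with `p`
homogeneous of degree `k ≥ 1`, and for each monomial of `p` the number of distinct variables
appearing in it is `k_i`, then for every `t ≥ C`,
`P(g(X) ≥ t) ≤ (∑_i k_i) · f((t − C)^{1/k} / (∑_i |a_i|)^{1/k})`. -/
theorem union_bound_homogeneous_polynomial
    (n k : ℕ) (hn : 1 ≤ n) (hk : 1 ≤ k)
    (p : MvPolynomial (Fin n) ℝ) (hp : p.IsHomogeneous k)
    (C : ℝ)
    (hA : 0 < ∑ d ∈ p.support, |MvPolynomial.coeff d p|)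
    (f : ℝ → ℝ)
    (hf_cont : ContinuousOn f (Ici 0))
    (hf_anti : StrictAntiOn f (Ici 0))
    (hf_pos : ∀ t, 0 ≤ t → 0 < f t)
    (hf_one : 1 ≤ f 0)
    (hf_lim : Tendsto f atTop (nhds 0))
    {Ω : Type*} [MeasurableSpace Ω] (μ : Measure Ω) [IsProbabilityMeasure μ]
    (X : Ω → Fin n → ℝ) (hX : Measurable X)
    (hTail : ∀ i t, 0 ≤ t → μ {ω | t ≤ |X ω i|} ≤ ENNReal.ofReal (f t))
    (t : ℝ) (ht : C ≤ t) :
    μ {ω | t ≤ MvPolynomial.eval (X ω) p + C} ≤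
      ENNReal.ofReal ((∑ d ∈ p.support, (d.support.card : ℝ)) *
        f ((t - C) ^ (1 / (k : ℝ)) /
          (∑ d ∈ p.support, |MvPolynomial.coeff d p|) ^ (1 / (k : ℝ)))) := by
  set A := ∑ d ∈ p.support, |MvPolynomial.coeff d p| with hAdef
  set s := (t - C) ^ (1 / (k : ℝ)) / A ^ (1 / (k : ℝ)) with hsdef
  have htC : 0 ≤ t - C := sub_nonneg.mpr ht
  have hs : 0 ≤ s := div_nonneg (Real.rpow_nonneg htC _) (Real.rpow_nonneg hA.le _)
  have hk0 : k ≠ 0 := by omega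
  have hsk : A * s ^ k = t - C := by
    rw [hsdef, div_pow, one_div, Real.rpow_inv_natCast_pow htC hk0,
      Real.rpow_inv_natCast_pow hA.le hk0, mul_div_cancel₀ _ hA.ne']
  have hp0 : p.support.Nonempty := by
    rw [Finset.nonempty_iff_ne_empty]
    intro he
    simp [hAdef, he] at hA
  have hsub : {ω | t ≤ MvPolynomial.eval (X ω) p + C} ⊆
      ⋃ d ∈ p.support, ⋃ i ∈ d.support, {ω | s ≤ |X ω i|} := by
    intro ω hω
    by_contra hcon
    simp only [mem_iUnion, mem_ofPred_eq, not_exists, not_le] at hcon hω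
    have hlt := eval_lt_of_forall_abs_lt hk p hp hp0 (X ω) s hcon
    linarith
  calc μ {ω | t ≤ MvPolynomial.eval (X ω) p + C}
      ≤ μ (⋃ d ∈ p.support, ⋃ i ∈ d.support, {ω | s ≤ |X ω i|}) := measure_mono hsub
    _ ≤ ∑ d ∈ p.support, ∑ i ∈ d.support, μ {ω | s ≤ |X ω i|} :=
        (measure_biUnion_finset_le _ _).trans
          (Finset.sum_le_sum fun _ _ => measure_biUnion_finset_le _ _)
    _ ≤ ∑ d ∈ p.support, ∑ _i ∈ d.support, ENNReal.ofReal (f s) :=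
        Finset.sum_le_sum fun _ _ => Finset.sum_le_sum fun i _ => hTail i s hs
    _ = ENNReal.ofReal ((∑ d ∈ p.support, (d.support.card : ℝ)) * f s) := by
        rw [ENNReal.ofReal_mul (Finset.sum_nonneg fun _ _ => Nat.cast_nonneg _),
          ENNReal.ofReal_sum_of_nonneg fun _ _ => Nat.cast_nonneg _, Finset.sum_mul]
        simp only [Finset.sum_const, nsmul_eq_mul, ENNReal.ofReal_natCast]
end
end

section
/- Let n ≥ 1, let f = (f_1,…,f_n) ∈ 𝓑_c^n, and let V ⊆ ℝ^n be nonempty and closed. Then the supremum over X ∈ 𝒯^d(f) of P(X ∈ V) equals the supremum over X ∈ 𝒯^d(f) of P(X ∈ ∂_SW Q(V)), where Q(V) ⊆ [0,∞)^n denotes the image of V under Q. -/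
open MeasureTheory Filter Set

noncomputable section

/-- Flip the signs of the coordinates of `x` according to `σ`. -/
def signFlip {n : ℕ} (σ : Fin n → ℤˣ) (x : Fin n → ℝ) : Fin n → ℝ :=
  fun i => ((σ i : ℤ) : ℝ) * x i

lemma continuous_signFlip {n : ℕ} (σ : Fin n → ℤˣ) : Continuous (signFlip σ) := by
  unfold signFlip
  fun_prop

lemma abs_signFlip {n : ℕ} (σ : Fin n → ℤˣ) (x : Fin n → ℝ) (i : Fin n) :
    |signFlip σ x i| = |x i| := by
  rcases Int.units_eq_one_or (σ i) with h | h <;> simp [signFlip, h]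

lemma exists_signFlip_Qmap {n : ℕ} (v : Fin n → ℝ) : ∃ σ, signFlip σ (Qmap v) = v := by
  refine ⟨fun i => if 0 ≤ v i then 1 else -1, funext fun i => ?_⟩
  by_cases h : 0 ≤ v i
  · simp [signFlip, Qmap, h, abs_of_nonneg h]
  · simp [signFlip, Qmap, h, abs_of_neg (not_le.mp h)]

lemma Qmap_image_eq {n : ℕ} (V : Set (Fin n → ℝ)) :
    Qmap '' V = Ici 0 ∩ ⋃ σ, signFlip σ ⁻¹' V := by
  ext x
  constructor
  · rintro ⟨v, hv, rfl⟩
    obtain ⟨σ, hσ⟩ := exists_signFlip_Qmap v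
    exact ⟨fun i => abs_nonneg _, mem_iUnion.mpr ⟨σ, by simpa [hσ] using hv⟩⟩
  · rintro ⟨hx, hxV⟩
    obtain ⟨σ, hσ⟩ := mem_iUnion.mp hxV
    exact ⟨_, hσ, funext fun i => (abs_signFlip σ x i).trans (abs_of_nonneg (hx i))⟩

lemma isClosed_Qmap_image {n : ℕ} {V : Set (Fin n → ℝ)} (hV : IsClosed V) :
    IsClosed (Qmap '' V) := by
  rw [Qmap_image_eq]
  exact isClosed_Ici.inter
    (isClosed_iUnion_of_finite fun σ => hV.preimage (continuous_signFlip σ))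

lemma measurable_Qmap {n : ℕ} : Measurable (Qmap (n := n)) := by
  have : Continuous (Qmap (n := n)) := by
    unfold Qmap
    fun_prop
  exact this.measurable

/-- There is a measurable way of choosing signs that sends `Qmap '' V` into `V`. -/
lemma exists_measurable_signs {n : ℕ} {V : Set (Fin n → ℝ)} (hV : MeasurableSet V) :
    ∃ g : (Fin n → ℝ) → Fin n → ℝ, Measurable g ∧ (∀ x i, |g x i| = |x i|) ∧
      ∀ x ∈ Qmap '' V, g x ∈ V := by
  classical
  suffices h : ∀ T : Finset (Fin n → ℤˣ), ∃ g : (Fin n → ℝ) → Fin n → ℝ, Measurable g ∧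
      (∀ x i, |g x i| = |x i|) ∧ ∀ x, (∃ σ ∈ T, signFlip σ x ∈ V) → g x ∈ V by
    obtain ⟨g, hg, habs, hgV⟩ := h Finset.univ
    refine ⟨g, hg, habs, fun x hx => hgV x ?_⟩
    rw [Qmap_image_eq] at hx
    obtain ⟨σ, hσ⟩ := mem_iUnion.mp hx.2
    exact ⟨σ, Finset.mem_univ _, hσ⟩
  intro T
  induction T using Finset.induction_on with
  | empty => exact ⟨id, measurable_id, fun _ _ => rfl, by simp⟩
  | insert σ T _ ih =>
    obtain ⟨g, hg, habs, hgV⟩ := ih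
    have hσ := (continuous_signFlip σ).measurable
    refine ⟨(signFlip σ ⁻¹' V).piecewise (signFlip σ) g, hσ.piecewise (hσ hV) hg, ?_, ?_⟩
    · intro x i
      by_cases hx : x ∈ signFlip σ ⁻¹' V
      · simp only [piecewise_eq_of_mem _ _ _ hx, abs_signFlip]
      · simp only [piecewise_eq_of_notMem _ _ _ hx, habs]
    · rintro x ⟨τ, hτ, hτV⟩
      by_cases hx : x ∈ signFlip σ ⁻¹' V
      · rwa [piecewise_eq_of_mem _ _ _ hx]
      · rw [piecewise_eq_of_notMem _ _ _ hx]
        rcases Finset.mem_insert.mp hτ with rfl | hτ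
        · exact absurd hτV hx
        · exact hgV x ⟨τ, hτ, hτV⟩

/-- Lowering the coordinate `a` as far as possible inside a closed upper set is measurable. -/
lemma exists_measurable_lower_coord {ι : Type*} [DecidableEq ι] {U : Set (ι → ℝ)}
    [Countable ι] (hU : IsClosed U) (hUup : IsUpperSet U) (hU0 : U ⊆ Ici 0) (a : ι) :
    ∃ ψ : (ι → ℝ) → ι → ℝ, Measurable ψ ∧ (∀ x, 0 ≤ x → 0 ≤ ψ x ∧ ψ x ≤ x) ∧
      ∀ x ∈ U, ψ x ∈ U ∧ ∀ t < ψ x a, Function.update (ψ x) a t ∉ U := by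
  let S (x : ι → ℝ) : Set ℝ := {t | 0 ≤ t ∧ (Function.update x a t ∈ U ∨ x a ≤ t)}
  have hSne (x) : (S x).Nonempty := ⟨max 0 (x a), le_max_left _ _, .inr (le_max_right _ _)⟩
  have hSbdd (x) : BddBelow (S x) := ⟨0, fun t ht => ht.1⟩
  have hScl (x) : IsClosed (S x) :=
    isClosed_Ici.inter ((hU.preimage (continuous_const.update a continuous_id)).union isClosed_Ici)
  have hmem (x) : sInf (S x) ∈ S x := (hScl x).csInf_mem (hSne x) (hSbdd x)
  have hSup (x) : IsUpperSet (S x) := fun s t hst hs =>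
    ⟨hs.1.trans hst, hs.2.imp (hUup (Function.update_mono hst)) (le_trans · hst)⟩
  have hmeas : Measurable fun x => sInf (S x) := by
    refine measurable_of_Iic fun c => ?_
    have hc : (fun x => sInf (S x)) ⁻¹' Iic c = {x | c ∈ S x} := by
      ext x
      exact ⟨fun h => hSup x h (hmem x), fun h => csInf_le (hSbdd x) h⟩
    rw [hc]
    have hcl : IsClosed {x : ι → ℝ | Function.update x a c ∈ U ∨ x a ≤ c} :=
      (hU.preimage (continuous_id.update a continuous_const)).union
        (isClosed_le (continuous_apply a) continuous_const)
    exact (MeasurableSet.const (0 ≤ c)).inter hcl.measurableSet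
  refine ⟨fun x => Function.update x a (sInf (S x)), ?_, fun x hx => ⟨?_, ?_⟩,
    fun x hx => ⟨?_, fun t ht htU => ?_⟩⟩
  · refine measurable_pi_iff.mpr fun i => ?_
    rcases eq_or_ne i a with rfl | hi
    · simpa using hmeas
    · simpa [hi] using measurable_pi_apply i
  · exact le_update_iff.mpr ⟨(hmem x).1, fun i _ => hx i⟩
  · exact update_le_iff.mpr ⟨csInf_le (hSbdd x) ⟨hx a, .inr le_rfl⟩, fun _ _ => le_rfl⟩
  · exact (hmem x).2.elim id fun h => hUup (le_update_iff.mpr ⟨h, fun _ _ => le_rfl⟩) hx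
  · simp only [Function.update_self] at ht
    simp only [Function.update_idem] at htU
    refine ht.not_ge (csInf_le (hSbdd x) ⟨?_, .inl htU⟩)
    simpa using hU0 htU a

/-- There is a measurable map that decreases every point of a closed upper set `U` of the
nonnegative orthant to a minimal element of `U`. -/
lemma exists_measurable_minimal {ι : Type*} [Finite ι] {U : Set (ι → ℝ)}
    (hU : IsClosed U) (hUup : IsUpperSet U) (hU0 : U ⊆ Ici 0) :
    ∃ φ : (ι → ℝ) → ι → ℝ, Measurable φ ∧ (∀ x, 0 ≤ x → 0 ≤ φ x ∧ φ x ≤ x) ∧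
      ∀ x ∈ U, φ x ∈ U ∧ ∀ y ∈ U, y ≤ φ x → y = φ x := by
  classical
  have := Fintype.ofFinite ι
  have h (s : Finset ι) : ∃ φ : (ι → ℝ) → ι → ℝ, Measurable φ ∧
      (∀ x, 0 ≤ x → 0 ≤ φ x ∧ φ x ≤ x) ∧
      ∀ x ∈ U, φ x ∈ U ∧ ∀ i ∈ s, ∀ t < φ x i, Function.update (φ x) i t ∉ U := by
    induction s using Finset.induction_on with
    | empty => exact ⟨id, measurable_id, fun x hx => ⟨hx, le_rfl⟩, by simp⟩
    | insert a s _ ih =>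
      obtain ⟨φ, hφ, hφle, hφU⟩ := ih
      obtain ⟨ψ, hψ, hψle, hψU⟩ := exists_measurable_lower_coord hU hUup hU0 a
      refine ⟨ψ ∘ φ, hψ.comp hφ, fun x hx => ?_, fun x hx => ?_⟩
      · obtain ⟨h0, h1⟩ := hφle x hx
        exact ⟨(hψle _ h0).1, (hψle _ h0).2.trans h1⟩
      · obtain ⟨hxU, hmin⟩ := hφU x hx
        obtain ⟨hxU', hmin'⟩ := hψU _ hxU
        have hle := (hψle _ (hU0 hxU)).2
        refine ⟨hxU', fun i hi t ht htU => ?_⟩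
        rcases Finset.mem_insert.mp hi with rfl | hi
        · exact hmin' t ht htU
        · exact hmin i hi t (ht.trans_le (hle i))
            (hUup (update_le_update_iff.mpr ⟨le_rfl, fun j _ => hle j⟩) htU)
  obtain ⟨φ, hφ, hφle, hφU⟩ := h Finset.univ
  refine ⟨φ, hφ, hφle, fun x hx => ⟨(hφU x hx).1, fun y hy hyx => ?_⟩⟩
  by_contra hne
  obtain ⟨i, hi⟩ := Function.ne_iff.mp hne
  exact (hφU x hx).2 i (Finset.mem_univ i) (y i) (lt_of_le_of_ne (hyx i) hi)
    (hUup (le_update_iff.mpr ⟨le_rfl, fun j _ => hyx j⟩) hy)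

/-- There is a measurable map that does not increase absolute values and sends `V` into the
southwest boundary of `Qmap '' V`. -/
lemma exists_measurable_swBoundary {n : ℕ} {V : Set (Fin n → ℝ)} (hV : IsClosed V) :
    ∃ φ : (Fin n → ℝ) → Fin n → ℝ, Measurable φ ∧ (∀ x i, |φ x i| ≤ |x i|) ∧
      ∀ x ∈ V, φ x ∈ swBoundary (Qmap '' V) := by
  have hW0 : Qmap '' V ⊆ Ici 0 := by
    rw [Qmap_image_eq]
    exact inter_subset_left
  have hU0 : (upperClosure (Qmap '' V) : Set (Fin n → ℝ)) ⊆ Ici 0 :=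
    upperClosure_min hW0 (isUpperSet_Ici 0)
  obtain ⟨φ, hφ, hφle, hφU⟩ := exists_measurable_minimal
    ((isClosed_Qmap_image hV).upperClosure_pi ⟨0, hW0⟩) (upperClosure _).upper hU0
  refine ⟨φ ∘ Qmap, hφ.comp measurable_Qmap, fun x i => ?_, fun x hx => ?_⟩
  · obtain ⟨h0, h1⟩ := hφle (Qmap x) fun i => abs_nonneg _
    rw [Function.comp_apply, abs_of_nonneg (h0 i)]
    exact h1 i
  · obtain ⟨hmem, hmin⟩ := hφU (Qmap x) (subset_upperClosure (mem_image_of_mem _ hx))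
    obtain ⟨w, hw, hwle⟩ := mem_upperClosure.mp hmem
    have hwW := hmin w (subset_upperClosure hw) hwle
    exact ⟨(hwW ▸ hw : φ (Qmap x) ∈ Qmap '' V), fun y hy => hmin y (subset_upperClosure hy)⟩

/-- Pushing a law forward along a measurable map that does not increase absolute values
preserves tail bounds. -/
lemma map_tail_le {n : ℕ} {f : Fin n → ℝ → ℝ} {ν : Measure (Fin n → ℝ)}
    (hν : ∀ (i : Fin n) (t : ℝ), 0 ≤ t → ν {x | t ≤ |x i|} ≤ ENNReal.ofReal (f i t))
    {φ : (Fin n → ℝ) → Fin n → ℝ} (hφ : Measurable φ) (hle : ∀ x i, |φ x i| ≤ |x i|)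
    (i : Fin n) (t : ℝ) (ht : 0 ≤ t) :
    ν.map φ {x | t ≤ |x i|} ≤ ENNReal.ofReal (f i t) := by
  have hs : IsClosed {x : Fin n → ℝ | t ≤ |x i|} :=
    isClosed_le continuous_const (continuous_apply i).abs
  rw [Measure.map_apply hφ hs.measurableSet]
  exact (measure_mono fun x hx => le_trans hx (hle x i)).trans (hν i t ht)

/-- If a measurable map that does not increase absolute values sends `A` into `B`, then the
supremum of the probabilities of `A` under the tail bounds is at most that of `B`. -/
lemma iSup_measure_le_of_map {n : ℕ} {f : Fin n → ℝ → ℝ} {A B : Set (Fin n → ℝ)}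
    {φ : (Fin n → ℝ) → Fin n → ℝ} (hφ : Measurable φ) (hle : ∀ x i, |φ x i| ≤ |x i|)
    (hAB : MapsTo φ A B) :
    (⨆ ν : {ν : Measure (Fin n → ℝ) // IsProbabilityMeasure ν ∧
        ∀ (i : Fin n) (t : ℝ), 0 ≤ t → ν {x | t ≤ |x i|} ≤ ENNReal.ofReal (f i t)},
      (ν : Measure (Fin n → ℝ)) A) ≤
    (⨆ ν : {ν : Measure (Fin n → ℝ) // IsProbabilityMeasure ν ∧
        ∀ (i : Fin n) (t : ℝ), 0 ≤ t → ν {x | t ≤ |x i|} ≤ ENNReal.ofReal (f i t)},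
      (ν : Measure (Fin n → ℝ)) B) := by
  refine iSup_le fun ⟨ν, hprob, hν⟩ => ?_
  refine le_iSup_of_le ⟨ν.map φ, Measure.isProbabilityMeasure_map hφ.aemeasurable,
    map_tail_le hν hφ hle⟩ ?_
  exact (measure_mono hAB).trans (Measure.le_map_apply hφ.aemeasurable B)

/-- **Main southwest boundary result.** For `f ∈ 𝓑_c^n` and a nonempty closed `V ⊆ ℝ^n`,
the supremum over `X ∈ 𝒯^d(f)` of `P(X ∈ V)` equals the supremum over `X ∈ 𝒯^d(f)` of
`P(X ∈ ∂_SW Q(V))` (random vectors in `𝒯^d(f)` being identified with their laws, i.e.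
probability measures on `ℝ^n` satisfying the tail bounds). -/
theorem sup_prob_eq_sup_prob_sw_boundary
    (n : ℕ) (hn : 1 ≤ n)
    (f : Fin n → ℝ → ℝ)
    (hf_cont : ∀ i, ContinuousOn (f i) (Ici 0))
    (hf_anti : ∀ i, StrictAntiOn (f i) (Ici 0))
    (hf_pos : ∀ i t, 0 ≤ t → 0 < f i t)
    (hf_one : ∀ i, 1 ≤ f i 0)
    (hf_lim : ∀ i, Tendsto (f i) atTop (nhds 0))
    (V : Set (Fin n → ℝ)) (hV_ne : V.Nonempty) (hV_closed : IsClosed V) :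
    (⨆ ν : {ν : Measure (Fin n → ℝ) // IsProbabilityMeasure ν ∧
        ∀ (i : Fin n) (t : ℝ), 0 ≤ t → ν {x | t ≤ |x i|} ≤ ENNReal.ofReal (f i t)},
      (ν : Measure (Fin n → ℝ)) V) =
    (⨆ ν : {ν : Measure (Fin n → ℝ) // IsProbabilityMeasure ν ∧
        ∀ (i : Fin n) (t : ℝ), 0 ≤ t → ν {x | t ≤ |x i|} ≤ ENNReal.ofReal (f i t)},
      (ν : Measure (Fin n → ℝ)) (swBoundary (Qmap '' V))) := by
  obtain ⟨φ, hφ, hφle, hφV⟩ := exists_measurable_swBoundary hV_closed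
  obtain ⟨g, hg, habs, hgV⟩ := exists_measurable_signs hV_closed.measurableSet
  exact le_antisymm (iSup_measure_le_of_map hφ hφle hφV)
    (iSup_measure_le_of_map hg (fun x i => (habs x i).le) fun x hx => hgV x hx.1)
end
end
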